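/- Let f : ℂ^n × Ω → W be a function differentiable in the variables λ. Define (Z_m f)(z,λ) = K_m(z;λ)^{−1} f(z_1,…,z_m+p,…,z_n, λ) and (D_a f)(z,λ) = p λ_a (∂f/∂λ_a)(z,λ) + L_a(z;λ) f(z,λ). Then for all m ∈ {1,…,n} and a ∈ {1,…,N}, and at every point (z,λ) with λ ∈ Ω and z satisfying the genericity condition, (Z_m(D_a f))(z,λ) = (D_a(Z_m f))(z,λ): the qKZ difference operators commute with the dynamical differential operators on W-valued functions. -/

import Mathlib

noncomputable section

/-- Basis of `W = (ℂ^N)^{⊗n}`: multi-indices `Fin n → Fin N`. -/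
abbrev BIdx (N n : ℕ) := Fin n → Fin N

/-- `End(W)` realized as matrices in the standard tensor basis of `W = (ℂ^N)^{⊗n}`. -/
abbrev EndW (N n : ℕ) := Matrix (BIdx N n) (BIdx N n) ℂ

/-- `E_{a,b}^{(i)}`: the matrix unit `E_{a,b}` of `gl_N` acting in the `i`-th tensor
factor of `W` (it sends the basis vector `e_{m}` to `e_{m[i ↦ a]}` if `m i = b`). -/
def Ei {N n : ℕ} (i : Fin n) (a b : Fin N) : EndW N n :=
  Matrix.of fun k m => if k = Function.update m i a ∧ m i = b then 1 else 0

/-- `E_{a,b} = Σ_i E_{a,b}^{(i)}`. -/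
def Etot {N n : ℕ} (a b : Fin N) : EndW N n := ∑ i, Ei i a b

/-- The flip `P` acting in the `i`-th and `j`-th tensor factors of `W`. -/
def Pflip {N n : ℕ} (i j : Fin n) : EndW N n :=
  Matrix.of fun k m => if k = m ∘ Equiv.swap i j then 1 else 0

/-- The rational R-matrix `R(x) = (x·Id + P)/(x+1)` acting in factors `i,j` of `W`. -/
def Rm {N n : ℕ} (x : ℂ) (i j : Fin n) : EndW N n :=
  (x + 1)⁻¹ • (x • (1 : EndW N n) + Pflip i j)

/-- `Λ^{(m)}(λ) = diag(λ_1,…,λ_N)` acting in the `m`-th tensor factor of `W`. -/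
def LamD {N n : ℕ} (lam : Fin N → ℂ) (m : Fin n) : EndW N n :=
  Matrix.diagonal fun k => lam (k m)

/-- The dynamical operator coefficient `L_a(z;λ)` on `W`. -/
def Ldyn {N n : ℕ} (z : Fin n → ℂ) (lam : Fin N → ℂ) (a : Fin N) : EndW N n :=
  (2⁻¹ : ℂ) • (Etot a a) ^ 2
  - ∑ i, z i • Ei i a a
  - ∑ b : Fin N, ∑ i : Fin n, ∑ j : Fin n, (if i < j then Ei i a b * Ei j b a else 0)
  - ∑ b ∈ Finset.univ.erase a,
      (lam b / (lam a - lam b)) • (Etot a b * Etot b a - Etot a a)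

/-- Ordered product `R^{(1,m)}(z_1−z_m−p) ⋯ R^{(m−1,m)}(z_{m−1}−z_m−p)`. -/
def Kleft {N n : ℕ} (p : ℂ) (z : Fin n → ℂ) (m : Fin n) : EndW N n :=
  (((List.finRange n).filter (fun i => i < m)).map fun i => Rm (z i - z m - p) i m).prod

/-- Ordered product `R^{(m,n)}(z_m−z_n) R^{(m,n−1)}(z_m−z_{n−1}) ⋯ R^{(m,m+1)}(z_m−z_{m+1})`. -/
def Kright {N n : ℕ} (z : Fin n → ℂ) (m : Fin n) : EndW N n :=
  (((List.finRange n).filter (fun j => m < j)).reverse.map fun j => Rm (z m - z j) m j).prod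

/-- The qKZ operator coefficient `K_m(z;λ)` on `W`. -/
def Kqkz {N n : ℕ} (p : ℂ) (z : Fin n → ℂ) (lam : Fin N → ℂ) (m : Fin n) : EndW N n :=
  (Kleft p z m)⁻¹ * LamD lam m * Kright z m

/-- The genericity condition on `z`: for `i ≠ j`, the numbers `z_i−z_j`, `z_i−z_j+p`,
`z_i−z_j−p` avoid `{1, −1}`, so all R-matrix factors are defined and invertible. -/
def ZGeneric {n : ℕ} (p : ℂ) (z : Fin n → ℂ) : Prop :=
  ∀ i j : Fin n, i ≠ j →
    ∀ x ∈ ({z i - z j, z i - z j + p, z i - z j - p} : Set ℂ), x ≠ 1 ∧ x ≠ -1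

/-- `Ω = {λ ∈ ℂ^N : λ_1,…,λ_N nonzero and pairwise distinct}`. -/
def OmSet (N : ℕ) : Set (Fin N → ℂ) :=
  {lam | (∀ a, lam a ≠ 0) ∧ Function.Injective lam}

/-- The qKZ difference operator `Z_m`:
`(Z_m f)(z,λ) = K_m(z;λ)⁻¹ f(z_1,…,z_m+p,…,z_n, λ)`. -/
def Zqkz {N n : ℕ} (p : ℂ) (m : Fin n)
    (f : (Fin n → ℂ) → (Fin N → ℂ) → (BIdx N n → ℂ)) :
    (Fin n → ℂ) → (Fin N → ℂ) → (BIdx N n → ℂ) :=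
  fun z lam => (Kqkz p z lam m)⁻¹.mulVec (f (Function.update z m (z m + p)) lam)

/-- The dynamical differential operator `D_a`:
`(D_a f)(z,λ) = p λ_a (∂f/∂λ_a)(z,λ) + L_a(z;λ) f(z,λ)`. -/
def Ddyn {N n : ℕ} (p : ℂ) (a : Fin N)
    (f : (Fin n → ℂ) → (Fin N → ℂ) → (BIdx N n → ℂ)) :
    (Fin n → ℂ) → (Fin N → ℂ) → (BIdx N n → ℂ) :=
  fun z lam =>
    (p * lam a) • deriv (fun t : ℂ => f z (Function.update lam a t)) (lam a)
      + (Ldyn z lam a).mulVec (f z lam)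

section TensorFactors

variable {N n : ℕ}

lemma mul_Ei_apply (M : EndW N n) (i : Fin n) (a b : Fin N) (k l : BIdx N n) :
    (M * Ei i a b) k l = if l i = b then M k (Function.update l i a) else 0 := by
  by_cases h : l i = b <;> simp [Matrix.mul_apply, Ei, h]

lemma mul_Pflip_apply (M : EndW N n) (i j : Fin n) (k l : BIdx N n) :
    (M * (Pflip i j : EndW N n)) k l = M k (l ∘ Equiv.swap i j) := by
  simp [Matrix.mul_apply, Pflip]

lemma Pflip_mul_Ei (i j k : Fin n) (a b : Fin N) :
    Pflip i j * Ei k a b = Ei (Equiv.swap i j k) a b * Pflip i j := by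
  ext u v
  rw [mul_Ei_apply, mul_Pflip_apply]
  have h : Function.update v k a ∘ Equiv.swap i j
      = Function.update (v ∘ Equiv.swap i j) (Equiv.swap i j k) a := by
    ext l
    simp [Function.update_apply, Equiv.swap_apply_eq_iff]
  simp only [Pflip, Ei, Matrix.of_apply, h, Function.comp_apply, Equiv.swap_apply_self]
  by_cases hv : v k = b <;> simp [hv]

lemma Pflip_mul_self (i j : Fin n) : (Pflip i j * Pflip i j : EndW N n) = 1 := by
  ext u v
  rw [mul_Pflip_apply]
  simp [Pflip, Matrix.one_apply, Function.comp_assoc, ← Equiv.coe_trans]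

lemma Pflip_comm (i j : Fin n) : (Pflip i j : EndW N n) = Pflip j i := by
  simp [Pflip, Equiv.swap_comm]

lemma sum_Ei_mul_Ei (i j : Fin n) (h : i ≠ j) (a : Fin N) :
    ∑ b, Ei i a b * Ei j b a = (Ei i a a * Pflip i j : EndW N n) := by
  ext u v
  rw [Matrix.sum_apply, mul_Pflip_apply]
  simp only [mul_Ei_apply]
  have hu (b : Fin N) (hb : v i = b) (ha : v j = a) :
      Function.update (Function.update v j b) i a
        = Function.update (v ∘ Equiv.swap i j) i a := by
    ext l
    by_cases h1 : l = i
    · simp [h1]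
    · by_cases h2 : l = j
      · subst h2; simp [h1, hb]
      · simp [h1, h2, Equiv.swap_apply_of_ne_of_ne]
  by_cases ha : v j = a
  · simp only [ha, if_true, Ei, Matrix.of_apply, Function.comp_apply, Equiv.swap_apply_left]
    rw [Finset.sum_eq_single (v i)]
    · simp [hu _ rfl ha, h]
    · intro b _ hb
      simp [h, hb.symm]
    · simp
  · simp [ha, Ei]

lemma Ei_mul_Ei_self (i : Fin n) (a b : Fin N) :
    (Ei i a b * Ei i b a : EndW N n) = Ei i a a := by
  ext u v
  rw [mul_Ei_apply]
  by_cases h : v i = a <;> simp [Ei, h]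

lemma Ei_diag_comm (i j : Fin n) (a : Fin N) :
    (Ei i a a * Ei j a a : EndW N n) = Ei j a a * Ei i a a := by
  ext u v
  by_cases hij : i = j
  · rw [hij]
  rw [mul_Ei_apply, mul_Ei_apply]
  by_cases hi : v i = a <;> by_cases hj : v j = a
  · have h (l : Fin n) (hl : v l = a) : Function.update v l a = v := by
      rw [← hl, Function.update_eq_self]
    simp [Ei, hi, hj, h]
  all_goals simp [Ei, hi, hj, hij, Ne.symm hij]

lemma LamD_mul_Ei (lam : Fin N → ℂ) (m i : Fin n) (a b : Fin N) (hb : lam b ≠ 0) :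
    (LamD lam m * Ei i a b : EndW N n)
      = (if i = m then lam a / lam b else 1) • (Ei i a b * LamD lam m) := by
  ext u v
  rw [mul_Ei_apply, Matrix.smul_apply]
  simp only [LamD, Matrix.mul_diagonal, Matrix.diagonal_apply]
  by_cases hv : v i = b
  · by_cases hu : u = Function.update v i a
    · subst hu
      by_cases him : i = m
      · subst him
        simp [Ei, hv]
        field_simp
      · simp [Ei, hv, him, Function.update_of_ne (Ne.symm him)]
    · simp [Ei, hv, hu]
  · simp [Ei, hv]

lemma LamD_mul_Ei_diag (lam : Fin N → ℂ) (m i : Fin n) (a : Fin N) (ha : lam a ≠ 0) :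
    (LamD lam m * Ei i a a : EndW N n) = Ei i a a * LamD lam m := by
  rw [LamD_mul_Ei lam m i a a ha, div_self ha, ite_self, one_smul]

lemma LamD_mul_Etot_diag (lam : Fin N → ℂ) (m : Fin n) (a : Fin N) (ha : lam a ≠ 0) :
    (LamD lam m * Etot a a : EndW N n) = Etot a a * LamD lam m := by
  simp only [Etot, Finset.mul_sum, Finset.sum_mul, LamD_mul_Ei_diag lam m _ a ha]

lemma Pflip_mul_Etot (i j : Fin n) (a b : Fin N) :
    (Pflip i j * Etot a b : EndW N n) = Etot a b * Pflip i j := by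
  simp only [Etot, Finset.mul_sum, Finset.sum_mul, Pflip_mul_Ei]
  exact Equiv.sum_comp (Equiv.swap i j) (fun k => Ei k a b * Pflip i j)

lemma LamD_mul_LamD_inv (lam : Fin N → ℂ) (h : ∀ a, lam a ≠ 0) (m : Fin n) :
    (LamD lam m * LamD lam⁻¹ m : EndW N n) = 1 := by
  simp [LamD, h]

end TensorFactors

section Ordering

variable {N n : ℕ}

/-- The weighted sum of the operators `E_{a,b}^{(i)} E_{b,a}^{(k)}`. -/
def pairSum (a b : Fin N) (s : Fin n → Fin n → ℂ) : EndW N n :=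
  ∑ i, ∑ k, s i k • (Ei i a b * Ei k b a)

lemma pairSum_sub (a b : Fin N) (s t : Fin n → Fin n → ℂ) :
    pairSum a b s - pairSum a b t = pairSum a b (s - t) := by
  simp [pairSum, sub_smul, Finset.sum_sub_distrib]

lemma pairSum_add (a b : Fin N) (s t : Fin n → Fin n → ℂ) :
    pairSum a b s + pairSum a b t = pairSum a b (s + t) := by
  simp [pairSum, add_smul, Finset.sum_add_distrib]

lemma smul_pairSum (a b : Fin N) (c : ℂ) (s : Fin n → Fin n → ℂ) :
    c • pairSum a b s = pairSum a b (c • s) := by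
  simp [pairSum, Finset.smul_sum, smul_smul]

lemma Pflip_mul_pairSum (i j : Fin n) (a b : Fin N) (s : Fin n → Fin n → ℂ) :
    Pflip i j * pairSum a b s
      = pairSum a b (fun k l => s (Equiv.swap i j k) (Equiv.swap i j l)) * Pflip i j := by
  simp only [pairSum, Finset.mul_sum, Finset.sum_mul, mul_smul_comm, smul_mul_assoc,
    ← mul_assoc, Pflip_mul_Ei]
  simp only [mul_assoc, Pflip_mul_Ei]
  rw [← Equiv.sum_comp (Equiv.swap i j)]
  refine Finset.sum_congr rfl fun k _ => ?_
  rw [← Equiv.sum_comp (Equiv.swap i j)]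
  simp

/-- The weight of the linear order on tensor factors in which the factors other than `m` keep
their order and `m` stands right after those with index less than `q`. -/
def insertionOrder (m : Fin n) (q : ℕ) (i k : Fin n) : ℂ :=
  if i = m then (if k = m then 0 else if q ≤ k.val then 1 else 0)
  else if k = m then (if i.val < q then 1 else 0)
  else if i < k then 1 else 0

/-- The dynamical operator coefficient for an arbitrary ordering `s` of the tensor factors. -/
def orderedLdyn (s : Fin n → Fin n → ℂ) (z : Fin n → ℂ) (lam : Fin N → ℂ) (a : Fin N) :
    EndW N n :=
  (2⁻¹ : ℂ) • (Etot a a) ^ 2 - ∑ i, z i • Ei i a a - ∑ b : Fin N, pairSum a b s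
  - ∑ b ∈ Finset.univ.erase a,
      (lam b / (lam a - lam b)) • (Etot a b * Etot b a - Etot a a)

lemma Ldyn_eq_orderedLdyn (m : Fin n) (q : ℕ) (hq : q = m ∨ q = m + 1) (z : Fin n → ℂ)
    (lam : Fin N → ℂ) (a : Fin N) :
    Ldyn z lam a = orderedLdyn (insertionOrder m q) z lam a := by
  have h (i k : Fin n) : insertionOrder m q i k = if i < k then 1 else 0 := by
    unfold insertionOrder
    split_ifs <;> first | rfl | (exfalso; omega)
  simp only [Ldyn, orderedLdyn, pairSum, h, ite_smul, one_smul, zero_smul]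

lemma Rm_mul_orderedLdyn (i j : Fin n) (hij : i ≠ j) (s s' : Fin n → Fin n → ℂ)
    (hswap : ∀ k l, s (Equiv.swap i j k) (Equiv.swap i j l) = s' k l)
    (hsub : ∀ k l, s k l - s' k l
      = (if k = i ∧ l = j then 1 else 0) - if k = j ∧ l = i then 1 else 0)
    (z : Fin n → ℂ) (lam : Fin N → ℂ) (a : Fin N) :
    Rm (z i - z j) i j * orderedLdyn s z lam a
      = orderedLdyn s' z lam a * Rm (z i - z j) i j := by
  set P : EndW N n := Pflip i j with hP
  set T := ∑ b : Fin N, pairSum a b s with hT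
  set T' := ∑ b : Fin N, pairSum a b s' with hT'
  set D : EndW N n := ∑ i, z i • Ei i a a with hD
  have hPT : P * T = T' * P := by
    simp only [hT, hT', Finset.mul_sum, Finset.sum_mul, hP, Pflip_mul_pairSum, hswap]
  have hTT : T - T' = Ei i a a * P - Ei j a a * P := by
    rw [hT, hT', ← Finset.sum_sub_distrib, hP, ← sum_Ei_mul_Ei i j hij, Pflip_comm,
      ← sum_Ei_mul_Ei j i hij.symm, ← Finset.sum_sub_distrib]
    refine Finset.sum_congr rfl fun b _ => ?_
    rw [pairSum_sub]
    simp only [pairSum, Pi.sub_apply, hsub, sub_smul, ite_smul, one_smul, zero_smul,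
      Finset.sum_sub_distrib, ite_and]
    simp
  have hDP : P * D = D * P - (z i - z j) • (Ei i a a * P - Ei j a a * P) := by
    have h1 : P * D = (∑ k, z (Equiv.swap i j k) • Ei k a a) * P := by
      rw [← Equiv.sum_comp (Equiv.swap i j)]
      simp [hD, Finset.mul_sum, Finset.sum_mul, hP, Pflip_mul_Ei]
    have h2 : D - ∑ k, z (Equiv.swap i j k) • Ei k a a
        = (z i - z j) • (Ei i a a - Ei j a a) := by
      rw [hD, ← Finset.sum_sub_distrib, Finset.sum_eq_add i j hij]
      · simp only [Equiv.swap_apply_left, Equiv.swap_apply_right]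
        module
      · rintro k - ⟨h1, h2⟩
        rw [Equiv.swap_apply_of_ne_of_ne h1 h2, sub_self]
      · simp
      · simp
    rw [h1, ← sub_mul, ← smul_mul_assoc, ← h2]
    noncomm_ring
  set C : EndW N n := (2⁻¹ : ℂ) • (Etot a a) ^ 2 - ∑ b ∈ Finset.univ.erase a,
      (lam b / (lam a - lam b)) • (Etot a b * Etot b a - Etot a a) with hC
  have hPC : P * C = C * P := by
    have h2 (b c d e : Fin N) : P * (Etot b c * Etot d e) = Etot b c * Etot d e * P := by
      rw [← mul_assoc, hP, Pflip_mul_Etot, mul_assoc, Pflip_mul_Etot, mul_assoc]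
    simp only [hC, mul_sub, sub_mul, pow_two, Finset.mul_sum, Finset.sum_mul, mul_smul_comm,
      smul_mul_assoc, h2]
    simp only [hP, Pflip_mul_Etot]
  have e (r : Fin n → Fin n → ℂ) :
      orderedLdyn r z lam a = C - D - ∑ b : Fin N, pairSum a b r := by
    simp only [orderedLdyn, hC, hD]; abel
  rw [e, e, ← hT, ← hT', Rm, smul_mul_assoc, mul_smul_comm]
  congr 1
  have hT2 : T = T' + (Ei i a a * P - Ei j a a * P) := by rw [← hTT]; abel
  have : P * (C - D - T) = (C - D - T') * P + (z i - z j) • (Ei i a a * P - Ei j a a * P) := by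
    rw [mul_sub, mul_sub, hPT, hDP, hPC]; noncomm_ring
  rw [← hP, add_mul, this, hT2, mul_add, smul_mul_assoc, one_mul, mul_smul_comm, mul_one]
  module

lemma prod_mul_of_intertwine {M : Type*} [Monoid M] {n : ℕ} (f : Fin n → M) (G : ℕ → M)
    (h : ∀ j : Fin n, f j * G (j + 1) = G j * f j) :
    ((List.finRange n).map f).prod * G n = G 0 * ((List.finRange n).map f).prod := by
  induction n with
  | zero => simp
  | succ n ih =>
    have hl := h (Fin.last n)
    have := ih (fun j => f j.castSucc) fun j => h j.castSucc
    simp only [List.finRange_succ_last, List.map_append, List.map_map, List.prod_append,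
      List.map_cons, List.map_nil, List.prod_singleton, Function.comp_def]
    simp only [Fin.val_last] at hl
    rw [mul_assoc, hl, ← mul_assoc, this, mul_assoc]

lemma prod_reverse_mul_of_intertwine {M : Type*} [Monoid M] {n : ℕ} (f : Fin n → M)
    (G : ℕ → M) (h : ∀ j : Fin n, f j * G j = G (j + 1) * f j) :
    ((List.finRange n).reverse.map f).prod * G 0
      = G n * ((List.finRange n).reverse.map f).prod := by
  induction n with
  | zero => simp
  | succ n ih =>
    have hl := h (Fin.last n)
    have := ih (fun j => f j.castSucc) fun j => h j.castSucc
    simp only [List.map_reverse] at this ⊢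
    simp only [List.finRange_succ_last, List.map_append, List.map_map, List.reverse_append,
      List.prod_append, List.map_cons, List.map_nil, List.reverse_singleton,
      List.prod_singleton, Function.comp_def]
    simp only [Fin.val_last] at hl
    rw [mul_assoc, this, ← mul_assoc, hl, mul_assoc]

lemma prod_map_filter_eq {M α : Type*} [Monoid M] (l : List α) (q : α → Prop)
    [DecidablePred q] (f : α → M) :
    ((l.filter (fun i => q i)).map f).prod = (l.map fun i => if q i then f i else 1).prod := by
  induction l with
  | nil => simp
  | cons x l ih => by_cases h : q x <;> simp [h, ih]

lemma Kleft_mul_Ldyn (p : ℂ) (z : Fin n → ℂ) (lam : Fin N → ℂ) (m : Fin n) (a : Fin N) :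
    Kleft p z m * Ldyn (Function.update z m (z m + p)) lam a
      = orderedLdyn (insertionOrder m 0) (Function.update z m (z m + p)) lam a
        * Kleft p z m := by
  have := prod_mul_of_intertwine
    (fun i : Fin n => if i < m then (Rm (z i - z m - p) i m : EndW N n) else 1)
    (fun q => orderedLdyn (insertionOrder m (min q m)) (Function.update z m (z m + p)) lam a)
    (fun j => by
      by_cases h : j < m
      · have h' : j.val < m.val := h
        rw [if_pos h, min_eq_left (by omega), min_eq_left (by omega)]
        have hz : z j - z m - p
            = Function.update z m (z m + p) j - Function.update z m (z m + p) m := by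
          simp [h.ne]; ring
        rw [hz]
        refine Rm_mul_orderedLdyn j m h.ne _ _ (fun k l => ?_) (fun k l => ?_) _ _ _
        · simp only [Equiv.swap_apply_def, insertionOrder]
          split_ifs <;> first | rfl | (exfalso; omega)
        · simp only [insertionOrder]
          split_ifs <;> first | (exfalso; omega) | norm_num
      · have h' : m.val ≤ j.val := not_lt.mp h
        rw [if_neg h, min_eq_right (by omega), min_eq_right h', one_mul, mul_one])
  rw [Kleft, prod_map_filter_eq, Ldyn_eq_orderedLdyn m m (Or.inl rfl)]
  simpa [min_eq_right m.2.le] using this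

lemma Kright_mul_Ldyn (z : Fin n → ℂ) (lam : Fin N → ℂ) (m : Fin n) (a : Fin N) :
    Kright z m * Ldyn z lam a
      = orderedLdyn (insertionOrder m n) z lam a * Kright z m := by
  have := prod_reverse_mul_of_intertwine
    (fun j : Fin n => if m < j then (Rm (z m - z j) m j : EndW N n) else 1)
    (fun q => orderedLdyn (insertionOrder m (max q (m + 1))) z lam a)
    (fun j => by
      by_cases h : m < j
      · have h' : m.val < j.val := h
        rw [if_pos h, max_eq_left (by omega), max_eq_left (by omega)]
        refine Rm_mul_orderedLdyn m j h.ne _ _ (fun k l => ?_) (fun k l => ?_) _ _ _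
        · simp only [Equiv.swap_apply_def, insertionOrder]
          split_ifs <;> first | rfl | (exfalso; omega)
        · simp only [insertionOrder]
          split_ifs <;> first | (exfalso; omega) | norm_num
      · have h' : j.val ≤ m.val := not_lt.mp h
        rw [if_neg h, max_eq_right (by omega), max_eq_right (by omega), one_mul, mul_one])
  rw [Kright, ← List.filter_reverse, prod_map_filter_eq,
    Ldyn_eq_orderedLdyn m (m + 1) (Or.inr rfl)]
  simpa [max_eq_left (show m.val + 1 ≤ n from m.2)] using this

lemma pairSum_diag (a : Fin N) (m : Fin n) (q : ℕ) :
    pairSum a a (insertionOrder m q)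
      = (2⁻¹ : ℂ) • pairSum a a (fun i k : Fin n => if i = k then 0 else 1) := by
  have h : pairSum a a (insertionOrder m q)
      = pairSum a a (fun i k => insertionOrder m q k i) := by
    rw [pairSum, Finset.sum_comm, pairSum]
    simp only [Ei_diag_comm]
  have h2 : pairSum a a (fun i k : Fin n => if i = k then 0 else 1)
      = pairSum a a (insertionOrder m q) + pairSum a a (insertionOrder m q) := by
    nth_rewrite 2 [h]
    rw [pairSum_add]
    congr 1
    ext i k
    simp only [Pi.add_apply, insertionOrder]
    split_ifs <;> first | (exfalso; omega) | norm_num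
  rw [h2]
  module

lemma Etot_mul_Etot_sub (a b : Fin N) :
    (Etot a b * Etot b a - Etot a a : EndW N n)
      = pairSum a b (fun i k => if i = k then 0 else 1) := by
  have h : (Etot a a : EndW N n) = pairSum a b (fun i k => if i = k then 1 else 0) := by
    simp [pairSum, Etot, Ei_mul_Ei_self]
  have h' : (Etot a b * Etot b a : EndW N n) = pairSum a b (fun _ _ => 1) := by
    simp [pairSum, Etot, Finset.sum_mul_sum]
  rw [h, h', pairSum_sub]
  congr 1
  ext i k
  by_cases hik : i = k <;> simp [hik]

lemma LamD_mul_pairSum (lam : Fin N → ℂ) (hlam : ∀ b, lam b ≠ 0) (m : Fin n) (a b : Fin N)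
    (s : Fin n → Fin n → ℂ) :
    LamD lam m * pairSum a b s
      = pairSum a b (fun i k => s i k * ((if i = m then lam a / lam b else 1)
          * (if k = m then lam b / lam a else 1))) * LamD lam m := by
  simp only [pairSum, Finset.mul_sum, Finset.sum_mul, mul_smul_comm, smul_mul_assoc]
  refine Finset.sum_congr rfl fun i _ => Finset.sum_congr rfl fun k _ => ?_
  rw [← mul_assoc, LamD_mul_Ei lam m i a b (hlam b), smul_mul_assoc, mul_assoc,
    LamD_mul_Ei lam m k b a (hlam a), mul_smul_comm, smul_smul, smul_smul, mul_assoc, mul_assoc]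

lemma LamD_mul_orderedLdyn (z : Fin n → ℂ) (lam : Fin N → ℂ) (hlam : lam ∈ OmSet N)
    (m : Fin n) (a : Fin N) :
    LamD lam m * orderedLdyn (insertionOrder m n) z lam a
      = orderedLdyn (insertionOrder m 0) z lam a * LamD lam m := by
  obtain ⟨h0, hinj⟩ := hlam
  set w : Fin n → Fin n → ℂ := fun i k => if i = k then 0 else 1 with hw
  set C : EndW N n := (2⁻¹ : ℂ) • (Etot a a) ^ 2 - ∑ i, z i • Ei i a a
    - (2⁻¹ : ℂ) • pairSum a a w with hC
  have e (q : ℕ) : orderedLdyn (insertionOrder m q) z lam a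
      = C - ∑ b ∈ Finset.univ.erase a,
          pairSum a b (insertionOrder m q + (lam b / (lam a - lam b)) • w) := by
    simp only [← pairSum_add, ← smul_pairSum, Finset.sum_add_distrib, orderedLdyn,
      Etot_mul_Etot_sub, hC, ← hw]
    rw [← Finset.add_sum_erase _ _ (Finset.mem_univ a), pairSum_diag]
    abel
  have hCL : LamD lam m * C = C * LamD lam m := by
    have h1 : LamD lam m * (Etot a a * Etot a a) = Etot a a * Etot a a * LamD lam m := by
      rw [← mul_assoc, LamD_mul_Etot_diag lam m a (h0 a), mul_assoc,
        LamD_mul_Etot_diag lam m a (h0 a), mul_assoc]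
    simp only [hC, mul_sub, sub_mul, pow_two, mul_smul_comm, smul_mul_assoc, h1, Finset.mul_sum,
      Finset.sum_mul, LamD_mul_Ei_diag lam m _ a (h0 a), LamD_mul_pairSum lam h0, div_self (h0 a),
      ite_self, mul_one]
  rw [e, e, mul_sub, sub_mul, hCL, Finset.mul_sum, Finset.sum_mul]
  congr 1
  refine Finset.sum_congr rfl fun b hb => ?_
  rw [LamD_mul_pairSum lam h0]
  congr 2
  ext i k
  have ha := h0 a
  have hb0 := h0 b
  have hab : lam a - lam b ≠ 0 :=
    sub_ne_zero.mpr fun h => Finset.ne_of_mem_erase hb (hinj h).symm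
  have := i.2
  have := k.2
  simp only [Pi.add_apply, Pi.smul_apply, smul_eq_mul, hw, insertionOrder]
  split_ifs <;> first | (exfalso; omega) | (field_simp; done) | (field_simp; ring)

end Ordering

section Invertibility

variable {N n : ℕ}

lemma isUnit_Rm (x : ℂ) (h1 : x ≠ 1) (h2 : x ≠ -1) (i j : Fin n) :
    IsUnit (Rm x i j : EndW N n) := by
  have hx1 : x + 1 ≠ 0 := fun h => h2 (eq_neg_of_add_eq_zero_left h)
  have hx2 : x - 1 ≠ 0 := sub_ne_zero.mpr h1
  refine IsUnit.of_mul_eq_one ((x - 1)⁻¹ • (x • (1 : EndW N n) - Pflip i j)) ?_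
  rw [Rm, smul_mul_smul_comm, add_mul, mul_sub, mul_sub, Pflip_mul_self]
  simp only [smul_mul_assoc, mul_smul_comm, one_mul, mul_one]
  have : x • x • (1 : EndW N n) - x • Pflip i j + (x • Pflip i j - 1)
      = ((x + 1) * (x - 1)) • (1 : EndW N n) := by module
  rw [this, smul_smul]
  convert one_smul ℂ (1 : EndW N n)
  field_simp

lemma isUnit_Kleft (p : ℂ) (z : Fin n → ℂ) (hz : ZGeneric p z) (m : Fin n) :
    IsUnit (Kleft p z m : EndW N n) := by
  refine List.prod_isUnit fun x hx => ?_
  obtain ⟨i, hi, rfl⟩ := List.mem_map.mp hx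
  have him : i < m := by simpa using hi
  have := hz i m him.ne (z i - z m - p) (by simp)
  exact isUnit_Rm _ this.1 this.2 _ _

lemma isUnit_Kright (p : ℂ) (z : Fin n → ℂ) (hz : ZGeneric p z) (m : Fin n) :
    IsUnit (Kright z m : EndW N n) := by
  refine List.prod_isUnit fun x hx => ?_
  obtain ⟨i, hi, rfl⟩ := List.mem_map.mp hx
  have him : m < i := by simpa using hi
  have := hz m i him.ne (z m - z i) (by simp)
  exact isUnit_Rm _ this.1 this.2 _ _

lemma Kqkz_inv (p : ℂ) (z : Fin n → ℂ) (hz : ZGeneric p z) (lam : Fin N → ℂ)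
    (h : ∀ a, lam a ≠ 0) (m : Fin n) :
    (Kqkz p z lam m)⁻¹ = (Kright z m)⁻¹ * (LamD lam⁻¹ m * Kleft p z m) := by
  rw [Kqkz, Matrix.mul_inv_rev, Matrix.mul_inv_rev, Matrix.nonsing_inv_nonsing_inv _
    ((Matrix.isUnit_iff_isUnit_det _).mp (isUnit_Kleft p z hz m)),
    Matrix.inv_eq_right_inv (LamD_mul_LamD_inv lam h m)]

end Invertibility

section Commutation

variable {N n : ℕ}

lemma orderedLdyn_update (s : Fin n → Fin n → ℂ) (p : ℂ) (z : Fin n → ℂ) (lam : Fin N → ℂ)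
    (m : Fin n) (a : Fin N) :
    orderedLdyn s (Function.update z m (z m + p)) lam a
      = orderedLdyn s z lam a - p • Ei m a a := by
  have : ∑ i, Function.update z m (z m + p) i • (Ei i a a : EndW N n)
      = ∑ i, z i • Ei i a a + p • Ei m a a := by
    rw [← Finset.add_sum_erase _ _ (Finset.mem_univ m),
      ← Finset.add_sum_erase _ (fun i => z i • Ei i a a) (Finset.mem_univ m),
      Finset.sum_congr rfl (g := fun i => z i • Ei i a a)
        fun i hi => by rw [Function.update_of_ne (Finset.ne_of_mem_erase hi)]]
    simp only [Function.update_self]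
    module
  simp only [orderedLdyn, this]
  abel

/-- The compatibility of the coefficients of the qKZ and dynamical operators. -/
lemma Kqkz_inv_mul_Ldyn (p : ℂ) (z : Fin n → ℂ) (hz : ZGeneric p z) (lam : Fin N → ℂ)
    (hlam : lam ∈ OmSet N) (m : Fin n) (a : Fin N) :
    (Kqkz p z lam m)⁻¹ * Ldyn (Function.update z m (z m + p)) lam a
      = Ldyn z lam a * (Kqkz p z lam m)⁻¹
        - p • ((Kright z m)⁻¹ * (Ei m a a * LamD lam⁻¹ m * Kleft p z m)) := by
  have hR := (Matrix.isUnit_iff_isUnit_det _).mp (isUnit_Kright (N := N) p z hz m)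
  have hΛ := LamD_mul_LamD_inv lam hlam.1 m
  have hΛ' := mul_eq_one_comm.mp hΛ
  have hright : Ldyn z lam a * (Kright z m)⁻¹
      = (Kright z m)⁻¹ * orderedLdyn (insertionOrder m n) z lam a := by
    calc Ldyn z lam a * (Kright z m)⁻¹
        = (Kright z m)⁻¹ * (Kright z m * Ldyn z lam a) * (Kright z m)⁻¹ := by
          rw [← mul_assoc, Matrix.nonsing_inv_mul _ hR, one_mul]
      _ = _ := by
          rw [Kright_mul_Ldyn, mul_assoc, mul_assoc, Matrix.mul_nonsing_inv _ hR, mul_one]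
  have hmid : LamD lam⁻¹ m * orderedLdyn (insertionOrder m 0) z lam a
      = orderedLdyn (insertionOrder m n) z lam a * LamD lam⁻¹ m := by
    calc LamD lam⁻¹ m * orderedLdyn (insertionOrder m 0) z lam a
        = LamD lam⁻¹ m * (orderedLdyn (insertionOrder m 0) z lam a * LamD lam m)
            * LamD lam⁻¹ m := by rw [mul_assoc, mul_assoc, hΛ, mul_one]
      _ = _ := by
          rw [← LamD_mul_orderedLdyn z lam hlam, ← mul_assoc, hΛ', one_mul]
  have hE := LamD_mul_Ei_diag lam⁻¹ m m a (inv_ne_zero (hlam.1 a))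
  rw [Kqkz_inv p z hz lam hlam.1, mul_assoc, mul_assoc, Kleft_mul_Ldyn, orderedLdyn_update,
    ← mul_assoc (Ldyn z lam a), hright, sub_mul, mul_sub, ← mul_assoc, hmid, smul_mul_assoc,
    mul_smul_comm, ← mul_assoc (LamD lam⁻¹ m) (Ei m a a), hE]
  simp only [mul_sub, mul_smul_comm, mul_assoc]

lemma isOpen_OmSet (N : ℕ) : IsOpen (OmSet N) := by
  have : OmSet N = (⋂ a, {lam | lam a ≠ 0}) ∩ ⋂ a, ⋂ b, {lam | a ≠ b → lam a ≠ lam b} := by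
    ext lam
    simp only [OmSet, Set.mem_ofPred_eq, Set.mem_inter_iff, Set.mem_iInter, Function.Injective]
    exact and_congr_right fun _ => forall₂_congr fun a b => not_imp_not.symm
  rw [this]
  refine (isOpen_iInter_of_finite fun a => isOpen_ne_fun (by fun_prop) (by fun_prop)).inter
    (isOpen_iInter_of_finite fun a => isOpen_iInter_of_finite fun b => ?_)
  by_cases h : a = b
  · simp [h]
  · simpa [h] using isOpen_ne_fun (f := fun lam : Fin N → ℂ => lam a) (by fun_prop)
      (by fun_prop)

lemma HasDerivAt.const_mulVec {ι κ : Type*} [Fintype ι] [Fintype κ] (M : Matrix κ ι ℂ)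
    {g : ℂ → ι → ℂ} {g' : ι → ℂ} {t : ℂ} (hg : HasDerivAt g g' t) :
    HasDerivAt (fun s => M.mulVec (g s)) (M.mulVec g') t :=
  (Matrix.mulVecLin M).toContinuousLinearMap.hasFDerivAt.comp_hasDerivAt t hg

lemma hasDerivAt_LamD_inv_mulVec (lam : Fin N → ℂ) (hlam : ∀ b, lam b ≠ 0) (m : Fin n)
    (a : Fin N) {g : ℂ → BIdx N n → ℂ} {g' : BIdx N n → ℂ} (hg : HasDerivAt g g' (lam a)) :
    HasDerivAt (fun t => (LamD (Function.update lam a t)⁻¹ m).mulVec (g t))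
      ((LamD lam⁻¹ m).mulVec g'
        - (lam a)⁻¹ • (Ei m a a * LamD lam⁻¹ m).mulVec (g (lam a))) (lam a) := by
  rw [hasDerivAt_pi] at hg ⊢
  intro k
  have hE : (Ei m a a : EndW N n) = LamD (Pi.single a 1) m := by
    ext u v
    by_cases huv : u = v
    · subst huv
      by_cases h : u m = a
      · subst h; simp [Ei, LamD]
      · simp [Ei, LamD, h]
    · by_cases h : v m = a
      · subst h; simp [Ei, LamD, huv]
      · simp [Ei, LamD, h, huv]
  rw [hE]
  simp only [LamD, Matrix.diagonal_mul_diagonal, Matrix.mulVec_diagonal, Pi.sub_apply,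
    Pi.smul_apply, smul_eq_mul, Pi.inv_apply]
  by_cases h : k m = a
  · simp only [h, Function.update_self, Pi.single_eq_same]
    refine ((hasDerivAt_inv (hlam a)).mul (hg k)).congr_deriv ?_
    have := hlam a
    field_simp
    ring
  · simp only [Function.update_of_ne h, Pi.single_eq_of_ne h]
    refine ((hg k).const_mul (lam (k m))⁻¹).congr_deriv ?_
    ring

end Commutation

/-- The qKZ difference operators commute with the dynamical differential operators on
`W`-valued functions of `(z, λ)`. -/
theorem qKZ_commutes_with_dynamical_on_functions {N n : ℕ}
    (p : ℂ) (hp : p ≠ 0)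
    (f : (Fin n → ℂ) → (Fin N → ℂ) → (BIdx N n → ℂ))
    (hf : ∀ z, DifferentiableOn ℂ (f z) (OmSet N))
    (m : Fin n) (a : Fin N)
    (z : Fin n → ℂ) (hz : ZGeneric p z)
    (lam : Fin N → ℂ) (hlam : lam ∈ OmSet N) :
    Zqkz p m (Ddyn p a f) z lam = Ddyn p a (Zqkz p m f) z lam := by
  have hlam0 := hlam.1
  set z' := Function.update z m (z m + p) with hz'
  set F := f z' lam with hF
  obtain ⟨F', hF'⟩ : ∃ F', HasDerivAt (fun t : ℂ => f z' (Function.update lam a t)) F' (lam a) := by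
    have h1 : DifferentiableAt ℂ (f z') (Function.update lam a (lam a)) := by
      rw [Function.update_eq_self]
      exact (hf z').differentiableAt ((isOpen_OmSet N).mem_nhds hlam)
    exact ⟨_, h1.hasFDerivAt.comp_hasDerivAt _ (hasDerivAt_update lam a (lam a))⟩
  have hZ : HasDerivAt (fun t : ℂ => Zqkz p m f z (Function.update lam a t))
      ((Kqkz p z lam m)⁻¹.mulVec F' - (lam a)⁻¹ •
        ((Kright z m)⁻¹ * (Ei m a a * LamD lam⁻¹ m * Kleft p z m)).mulVec F) (lam a) := by
    have h := (hasDerivAt_LamD_inv_mulVec lam hlam0 m a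
      (hF'.const_mulVec (Kleft p z m))).const_mulVec (Kright z m)⁻¹
    rw [Function.update_eq_self, ← hF] at h
    refine (h.congr_of_eventuallyEq ?_).congr_deriv ?_
    · filter_upwards [isOpen_ne.mem_nhds (hlam0 a)] with t ht
      have hne (b : Fin N) : Function.update lam a t b ≠ 0 := by
        by_cases hb : b = a
        · subst hb; simpa using ht
        · simpa [hb] using hlam0 b
      simp only [Zqkz, Kqkz_inv p z hz _ hne, Matrix.mulVec_mulVec, ← hz']
    · rw [Kqkz_inv p z hz _ hlam0]
      simp only [Matrix.mulVec_sub, Matrix.mulVec_smul, Matrix.mulVec_mulVec]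
  have hK := congrArg (fun M : EndW N n => M.mulVec F) (Kqkz_inv_mul_Ldyn p z hz lam hlam m a)
  simp only [Matrix.sub_mulVec, Matrix.smul_mulVec, ← Matrix.mulVec_mulVec, ← hz'] at hK
  rw [Ddyn, hZ.deriv]
  simp only [Zqkz, ← hz', Ddyn, hF'.deriv, ← hF]
  simp only [Matrix.mulVec_add, Matrix.mulVec_smul, hK, ← Matrix.mulVec_mulVec, smul_sub, smul_smul,
    mul_assoc, mul_inv_cancel₀ (hlam0 a), mul_one]
  abel
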